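/- (Lemma 3.5, isometry part for 1 < p < ∞, 𝕃 = ℝ.) Let (S, ℱ, μ) be a finite measure space, X a real Banach space with dual X*, and 1 < p < ∞, 1 < q < ∞ with 1/p + 1/q = 1. For every v ∈ L^q(μ, X*), the bounded linear functional F_v on L^p(μ, X) defined by F_v(u) = ∫_S v(t)(u(t)) dμ(t) satisfies ‖F_v‖ = ‖v‖_q, where ‖F_v‖ is the operator norm. -/

import Mathlib

open MeasureTheory Filter Topology
open scoped ENNReal

theorem exists_norm_le_one_mul_opNorm_le {X : Type*} [NormedAddCommGroup X] [NormedSpace ℝ X]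
    {r : ℝ} (hr : r < 1) (f : X →L[ℝ] ℝ) : ∃ x : X, ‖x‖ ≤ 1 ∧ r * ‖f‖ ≤ f x := by
  rcases eq_or_ne f 0 with rfl | hf
  · exact ⟨0, by simp⟩
  obtain ⟨x, hx, hfx⟩ := f.exists_lt_apply_of_lt_opNorm
    (mul_lt_of_lt_one_left (norm_pos_iff.2 hf) hr)
  rcases le_total 0 (f x) with h | h
  · exact ⟨x, hx.le, by simpa [abs_of_nonneg h] using hfx.le⟩
  · exact ⟨-x, by simpa using hx.le, by simpa [abs_of_nonpos h] using hfx.le⟩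

theorem norm_toLp_eq_integral_rpow_norm {S E : Type*} [MeasurableSpace S] {μ : Measure S}
    [NormedAddCommGroup E] {p : ℝ≥0∞} (hp : p ≠ 0) (hp' : p ≠ ∞) {f : S → E}
    (hf : MemLp f p μ) :
    ‖hf.toLp f‖ = (∫ t, ‖f t‖ ^ p.toReal ∂μ) ^ p.toReal⁻¹ := by
  rw [Lp.norm_toLp, hf.eLpNorm_eq_integral_rpow_norm hp hp', ENNReal.toReal_ofReal]
  exact Real.rpow_nonneg (integral_nonneg fun _ ↦ by positivity) _

/-- A simple function with values in the dual is normed by simple functions: map each value `f`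
to `‖f‖ ^ (q - 1)` times an almost norming vector of `f`. -/
theorem norm_toLp_simpleFunc_le_opNorm {S X : Type*} [MeasurableSpace S] {μ : Measure S}
    [IsFiniteMeasure μ] [NormedAddCommGroup X] [NormedSpace ℝ X] {p q : ℝ≥0∞} [Fact (1 ≤ p)]
    (hpq : p.toReal.HolderConjugate q.toReal) (s : SimpleFunc S (X →L[ℝ] ℝ))
    (F : Lp X p μ →L[ℝ] ℝ) (hF : ∀ u : Lp X p μ, F u = ∫ t, s t (u t) ∂μ) :
    ‖(s.memLp_of_isFiniteMeasure q μ).toLp s‖ ≤ ‖F‖ := by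
  have hp := ENNReal.toReal_pos_iff.1 hpq.pos
  have hq := ENNReal.toReal_pos_iff.1 hpq.symm.pos
  rw [norm_toLp_eq_integral_rpow_norm hq.1.ne' hq.2.ne]
  set I := ∫ t, ‖s t‖ ^ q.toReal ∂μ with hI
  have hI0 : 0 ≤ I := integral_nonneg fun _ ↦ by positivity
  rcases hI0.eq_or_lt with h0 | hIpos
  · rw [← h0, Real.zero_rpow (inv_ne_zero hpq.symm.ne_zero)]
    positivity
  have int_q : Integrable (fun t ↦ ‖s t‖ ^ q.toReal) μ :=
    (s.map fun f ↦ ‖f‖ ^ q.toReal).integrable_of_isFiniteMeasure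
  have key : ∀ r : ℝ, r < 1 → r * I ^ q.toReal⁻¹ ≤ ‖F‖ := by
    intro r hr
    choose g hg1 hg using exists_norm_le_one_mul_opNorm_le (X := X) hr
    let u : SimpleFunc S X := s.map fun f ↦ ‖f‖ ^ (q.toReal - 1) • g f
    have hu := u.memLp_of_isFiniteMeasure p μ
    have norm_u : ‖hu.toLp u‖ ≤ I ^ p.toReal⁻¹ := by
      rw [norm_toLp_eq_integral_rpow_norm hp.1.ne' hp.2.ne]
      refine Real.rpow_le_rpow (integral_nonneg fun _ ↦ by positivity) ?_
        (inv_nonneg.2 hpq.nonneg)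
      refine integral_mono (u.map fun x ↦ ‖x‖ ^ p.toReal).integrable_of_isFiniteMeasure int_q
        fun t ↦ ?_
      calc ‖u t‖ ^ p.toReal ≤ (‖s t‖ ^ (q.toReal - 1)) ^ p.toReal := by
            refine Real.rpow_le_rpow (norm_nonneg _) ?_ hpq.nonneg
            rw [SimpleFunc.map_apply, norm_smul, Real.norm_of_nonneg (by positivity)]
            exact mul_le_of_le_one_right (by positivity) (hg1 _)
        _ = ‖s t‖ ^ q.toReal := by
            rw [← Real.rpow_mul (norm_nonneg _), hpq.symm.sub_one_mul_conj]
    have F_u : r * I ≤ F (hu.toLp u) := by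
      have : F (hu.toLp u) = ∫ t, s t (u t) ∂μ := by
        rw [hF]
        refine integral_congr_ae ?_
        filter_upwards [hu.coeFn_toLp] with t ht
        rw [ht]
      rw [this, hI, ← integral_const_mul]
      have int_pairing : Integrable (fun t ↦ s t (u t)) μ :=
        (s.map fun f : X →L[ℝ] ℝ ↦
          f (‖f‖ ^ (q.toReal - 1) • g f)).integrable_of_isFiniteMeasure
      refine integral_mono (int_q.const_mul r) int_pairing fun t ↦ ?_
      have hpow : ‖s t‖ ^ q.toReal = ‖s t‖ ^ (q.toReal - 1) * ‖s t‖ := by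
        conv_rhs => rw [← Real.rpow_add_one' (norm_nonneg _) (by simpa using hpq.symm.ne_zero)]
        simp
      calc r * ‖s t‖ ^ q.toReal = ‖s t‖ ^ (q.toReal - 1) * (r * ‖s t‖) := by rw [hpow]; ring
        _ ≤ ‖s t‖ ^ (q.toReal - 1) * s t (g (s t)) := by gcongr; exact hg _
        _ = s t (u t) := by simp [u]
    have hle : r * I ≤ ‖F‖ * I ^ p.toReal⁻¹ := calc
      r * I ≤ ‖F (hu.toLp u)‖ := F_u.trans (le_abs_self _)
      _ ≤ ‖F‖ * ‖hu.toLp u‖ := F.le_opNorm _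
      _ ≤ _ := by gcongr
    have hsplit : I = I ^ q.toReal⁻¹ * I ^ p.toReal⁻¹ := by
      rw [← Real.rpow_add hIpos, hpq.symm.inv_add_inv_eq_one, Real.rpow_one]
    refine le_of_mul_le_mul_right ?_ (Real.rpow_pos_of_pos hIpos p.toReal⁻¹)
    rwa [mul_assoc, ← hsplit]
  have lim : Tendsto (fun r : ℝ ↦ r * I ^ q.toReal⁻¹) (𝓝[<] 1) (𝓝 (1 * I ^ q.toReal⁻¹)) :=
    (tendsto_id.mono_left nhdsWithin_le_nhds).mul_const _
  rw [one_mul] at lim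
  exact le_of_tendsto lim (eventually_mem_nhdsWithin.mono key)

/-- Lemma 3.5 of the paper (isometry part for 1 < p < ∞, 𝕃 = ℝ):
for v ∈ L^q(μ, X*), the bounded linear functional F_v(u) = ∫ v(t)(u(t)) dμ
on L^p(μ, X) satisfies ‖F_v‖ = ‖v‖_q. -/
theorem Fv_isometry
    {S : Type*} [MeasurableSpace S] (μ : Measure S) [IsFiniteMeasure μ]
    {X : Type*} [NormedAddCommGroup X] [NormedSpace ℝ X] [CompleteSpace X]
    (p q : ℝ≥0∞) [Fact (1 ≤ p)] (hp : 1 < p) (hp' : p ≠ ∞)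
    (hq : 1 < q) (hq' : q ≠ ∞) (hpq : p⁻¹ + q⁻¹ = 1)
    (v : Lp (X →L[ℝ] ℝ) q μ)
    (F : Lp X p μ →L[ℝ] ℝ)
    (hF : ∀ u : Lp X p μ, F u = ∫ t, v t (u t) ∂μ) :
    ‖F‖ = ‖v‖ := by
  have : Fact (1 ≤ q) := ⟨hq.le⟩
  have hconj : ENNReal.HolderConjugate p q := ENNReal.holderConjugate_iff.2 hpq
  have : ENNReal.HolderConjugate q p := hconj.symm
  have hreal : p.toReal.HolderConjugate q.toReal := by
    refine Real.holderConjugate_iff.2 ⟨?_, ?_⟩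
    · simpa using (ENNReal.toReal_lt_toReal ENNReal.one_ne_top hp').2 hp
    · rw [← ENNReal.toReal_inv, ← ENNReal.toReal_inv, ← ENNReal.toReal_add
        (ENNReal.inv_ne_top.2 (zero_lt_one.trans hp).ne')
        (ENNReal.inv_ne_top.2 (zero_lt_one.trans hq).ne'), hpq, ENNReal.toReal_one]
  let B := ContinuousLinearMap.id ℝ (X →L[ℝ] ℝ)
  let Φ := B.lpPairing μ q p
  have hΦ (w : Lp (X →L[ℝ] ℝ) q μ) (u : Lp X p μ) : Φ w u = ∫ t, w t (u t) ∂μ :=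
    B.lpPairing_eq_integral w u
  obtain rfl : F = Φ v := by
    ext u
    rw [hF, hΦ]
  refine le_antisymm ?_ ?_
  · refine (Φ v).opNorm_le_bound (norm_nonneg _) fun u ↦ ?_
    calc ‖Φ v u‖ = ‖L1.integral (B.holder 1 v u)‖ := by
          rw [L1.integral_eq_integral, hΦ, integral_congr_ae (B.coeFn_holder v u)]
          rfl
      _ ≤ ‖B.holder 1 v u‖ := L1.norm_integral_le _
      _ ≤ ‖B‖ * ‖v‖ * ‖u‖ := B.norm_holder_apply_apply_le v u
      _ ≤ 1 * ‖v‖ * ‖u‖ := by gcongr; exact ContinuousLinearMap.norm_id_le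
      _ = ‖v‖ * ‖u‖ := by rw [one_mul]
  · refine (Lp.simpleFunc.denseRange hq').induction_on (p := fun w ↦ ‖w‖ ≤ ‖Φ w‖) v
      (isClosed_le continuous_norm Φ.continuous.norm) fun w ↦ ?_
    let s := Lp.simpleFunc.toSimpleFunc w
    have hs : (s.memLp_of_isFiniteMeasure q μ).toLp s = (w : Lp (X →L[ℝ] ℝ) q μ) := by
      rw [← Lp.simpleFunc.toLp_eq_toLp, Lp.simpleFunc.toLp_toSimpleFunc]
    have hle := norm_toLp_simpleFunc_le_opNorm hreal s (Φ w) fun u ↦ by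
      rw [hΦ]
      refine integral_congr_ae ?_
      filter_upwards [Lp.simpleFunc.toSimpleFunc_eq_toFun w] with t ht
      rw [← ht]
    rwa [hs] at hle
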